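/- Wirtinger's inequality: if f, f′ ∈ L²(a,b), a < c < b, and f(c) = 0, then ∫_a^b |f(x)|² dx ≤ (4/π²) · max{(b−c)², (c−a)²} · ∫_a^b |f′(x)|² dx. -/

import Mathlib

open MeasureTheory

open Filter Topology in
/-- If `g` is differentiable at `0` within `[0, L]` and `g 0 = 0`, the function
`x ↦ cot (k x) ‖g x‖²` with `k = π / (2 L)` tends to `0` at the left end point. -/
lemma tendsto_cot_mul_norm_sq {E : Type*} [NormedAddCommGroup E] [NormedSpace ℝ E]
    {L : ℝ} (hL : 0 < L) {g : ℝ → E} {v : E}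
    (hg : HasDerivWithinAt g v (Set.Icc 0 L) 0) (hg0 : g 0 = 0) :
    Tendsto (fun x => Real.cot (Real.pi / (2 * L) * x) * ‖g x‖ ^ 2)
      (𝓝[Set.Icc 0 L] 0) (𝓝 0) := by
  obtain ⟨C, hC⟩ := hg.hasFDerivWithinAt.isBigO_sub.bound
  have hlim : Tendsto (fun x : ℝ => L * C ^ 2 * x) (𝓝[Set.Icc 0 L] 0) (𝓝 0) := by
    have : ContinuousWithinAt (fun x : ℝ => L * C ^ 2 * x) (Set.Icc 0 L) 0 := by fun_prop
    simpa [ContinuousWithinAt] using this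
  refine squeeze_zero_norm' ?_ hlim
  filter_upwards [hC, self_mem_nhdsWithin] with x hx hxL
  rcases hxL.1.eq_or_lt with rfl | hx0
  · simp [hg0]
  simp only [hg0, sub_zero, Real.norm_eq_abs, abs_of_pos hx0] at hx
  have hkx : Real.pi / (2 * L) * x ≤ Real.pi / 2 := by
    rw [div_mul_eq_mul_div, div_le_div_iff₀ (by positivity) (by norm_num)]
    nlinarith [hxL.2, Real.pi_pos]
  have hsin : x / L ≤ Real.sin (Real.pi / (2 * L) * x) := by
    refine le_trans (le_of_eq ?_) (Real.mul_le_sin (by positivity) hkx)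
    field_simp
  have hcot : |Real.cot (Real.pi / (2 * L) * x)| ≤ L / x := by
    rw [Real.cot_eq_cos_div_sin, abs_div, abs_of_pos ((by positivity : 0 < x / L).trans_le hsin),
      ← one_div_div x L]
    gcongr
    exact Real.abs_cos_le_one _
  rw [norm_mul, Real.norm_eq_abs, norm_pow, norm_norm]
  calc |Real.cot (Real.pi / (2 * L) * x)| * ‖g x‖ ^ 2
      ≤ L / x * (C * x) ^ 2 := by gcongr
    _ = L * C ^ 2 * x := by field_simp

/-- Wirtinger's inequality on `[0, L]` for functions vanishing at `0`. -/
lemma integral_norm_sq_le_of_eq_zero_left {E : Type*} [NormedAddCommGroup E]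
    [InnerProductSpace ℝ E] {L : ℝ} (hL : 0 < L) {g g' : ℝ → E}
    (hg : ∀ x ∈ Set.Icc 0 L, HasDerivWithinAt g (g' x) (Set.Icc 0 L) x) (hg0 : g 0 = 0)
    (hg2 : IntervalIntegrable (fun x => ‖g x‖ ^ 2) volume 0 L)
    (hg'2 : IntervalIntegrable (fun x => ‖g' x‖ ^ 2) volume 0 L) :
    (∫ x in (0 : ℝ)..L, ‖g x‖ ^ 2) ≤
      4 / Real.pi ^ 2 * L ^ 2 * ∫ x in (0 : ℝ)..L, ‖g' x‖ ^ 2 := by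
  set k : ℝ := Real.pi / (2 * L) with hk
  have hk0 : 0 < k := by positivity
  have hkL : k * L = Real.pi / 2 := by rw [hk]; field_simp
  have hsin : ∀ x, 0 < x → x ≤ L → 0 < Real.sin (k * x) := fun x h0 hxL =>
    Real.sin_pos_of_pos_of_lt_pi (by positivity) <| by
      have := mul_le_mul_of_nonneg_left hxL hk0.le
      linarith [Real.pi_pos]
  have hcot : ∀ x, 0 < x → x ≤ L → HasDerivAt (fun y => Real.cot (k * y))
      (-k * (1 + Real.cot (k * x) ^ 2)) x := by
    intro x h0 hxL
    have hs := (hsin x h0 hxL).ne'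
    have hlin : HasDerivAt (fun y => k * y) k x := by
      simpa using (hasDerivAt_id x).const_mul k
    have := hlin.cos.div hlin.sin hs
    simp only [Real.cot_eq_cos_div_sin]
    refine this.congr_deriv ?_
    field_simp
    ring
  have hcont : ContinuousOn (fun x => k * (Real.cot (k * x) * ‖g x‖ ^ 2)) (Set.Icc 0 L) := by
    intro x hx
    refine ContinuousWithinAt.const_mul ?_ k
    rcases hx.1.eq_or_lt with rfl | h0
    · simpa [ContinuousWithinAt, hg0] using tendsto_cot_mul_norm_sq hL (hg 0 hx) hg0
    · exact (hcot x h0 hx.2).continuousAt.continuousWithinAt.mul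
        ((hg x hx).continuousWithinAt.norm.pow 2)
  have hmain := intervalIntegral.sub_le_integral_of_hasDeriv_right_of_le hL.le hcont
    (g' := fun x => k * (-k * (1 + Real.cot (k * x) ^ 2) * ‖g x‖ ^ 2 +
      Real.cot (k * x) * (2 * inner ℝ (g x) (g' x))))
    (φ := fun x => ‖g' x‖ ^ 2 - k ^ 2 * ‖g x‖ ^ 2)
    (fun x hx => (((hcot x hx.1 hx.2.le).mul
      ((hg x ⟨hx.1.le, hx.2.le⟩).hasDerivAt (Icc_mem_nhds hx.1 hx.2)).norm_sq).const_mul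
        k).hasDerivWithinAt)
    ((intervalIntegrable_iff_integrableOn_Icc_of_le hL.le).1 (hg'2.sub (hg2.const_mul _)))
    (fun x _ => by
      have h := norm_sub_sq_real (g' x) ((k * Real.cot (k * x)) • g x)
      rw [inner_smul_right, norm_smul, mul_pow, Real.norm_eq_abs, sq_abs,
        real_inner_comm] at h
      nlinarith [sq_nonneg ‖g' x - (k * Real.cot (k * x)) • g x‖])
  rw [intervalIntegral.integral_sub hg'2 (hg2.const_mul _),
    intervalIntegral.integral_const_mul] at hmain
  simp only [hkL, hg0, Real.cot_eq_cos_div_sin, Real.cos_pi_div_two] at hmain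
  norm_num at hmain
  have hk2 : 4 / Real.pi ^ 2 * L ^ 2 = (k ^ 2)⁻¹ := by rw [hk]; field_simp; norm_num
  rw [hk2, inv_mul_eq_div, le_div_iff₀ (by positivity)]
  linarith

/-- Lemma 2.4, Wirtinger's inequality: if `f, f' ∈ L²(a,b)`,
`a < c < b` and `f(c) = 0`, then
`∫_a^b |f|² ≤ (4/π²)·max{(b-c)², (c-a)²}·∫_a^b |f'|²`. -/
theorem wirtinger_inequality
    (a b c : ℝ) (hac : a < c) (hcb : c < b)
    (f f' : ℝ → ℂ)
    (hderiv : ∀ x ∈ Set.Icc a b, HasDerivWithinAt f (f' x) (Set.Icc a b) x)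
    (hfc : f c = 0)
    (hf2 : IntervalIntegrable (fun x => ‖f x‖ ^ 2) MeasureTheory.volume a b)
    (hf'2 : IntervalIntegrable (fun x => ‖f' x‖ ^ 2) MeasureTheory.volume a b) :
    (∫ x in a..b, ‖f x‖ ^ 2) ≤
      4 / Real.pi ^ 2 * max ((b - c) ^ 2) ((c - a) ^ 2) * ∫ x in a..b, ‖f' x‖ ^ 2 := by
  have hc : c ∈ Set.uIcc a b := Set.mem_uIcc_of_le hac.le hcb.le
  have hleft : Set.uIcc a c ⊆ Set.uIcc a b := Set.uIcc_subset_uIcc_left hc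
  have hright : Set.uIcc c b ⊆ Set.uIcc a b := Set.uIcc_subset_uIcc_right hc
  have hl : (∫ x in a..c, ‖f x‖ ^ 2) ≤
      4 / Real.pi ^ 2 * (c - a) ^ 2 * ∫ x in a..c, ‖f' x‖ ^ 2 := by
    have h := integral_norm_sq_le_of_eq_zero_left (sub_pos.2 hac)
      (g := fun x => f (c - x)) (g' := fun x => -f' (c - x))
      (fun x hx => by
        have hmaps : Set.MapsTo (fun y => c - y) (Set.Icc 0 (c - a)) (Set.Icc a b) :=
          fun y hy => ⟨by linarith [hy.2], by linarith [hy.1]⟩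
        simpa [Function.comp_def] using (hderiv (c - x) (hmaps hx)).scomp x
          ((hasDerivAt_id x).const_sub c).hasDerivWithinAt hmaps)
      (by simpa using hfc)
      (by simpa using ((hf2.mono_set hleft).comp_sub_left c).symm)
      (by simpa using ((hf'2.mono_set hleft).comp_sub_left c).symm)
    simp only [norm_neg] at h
    rw [intervalIntegral.integral_comp_sub_left (fun x => ‖f x‖ ^ 2),
      intervalIntegral.integral_comp_sub_left (fun x => ‖f' x‖ ^ 2)] at h
    simpa using h
  have hr : (∫ x in c..b, ‖f x‖ ^ 2) ≤
      4 / Real.pi ^ 2 * (b - c) ^ 2 * ∫ x in c..b, ‖f' x‖ ^ 2 := by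
    have h := integral_norm_sq_le_of_eq_zero_left (sub_pos.2 hcb)
      (g := fun x => f (c + x)) (g' := fun x => f' (c + x))
      (fun x hx => by
        have hmaps : Set.MapsTo (fun y => c + y) (Set.Icc 0 (b - c)) (Set.Icc a b) :=
          fun y hy => ⟨by linarith [hy.1], by linarith [hy.2]⟩
        simpa [Function.comp_def] using (hderiv (c + x) (hmaps hx)).scomp x
          ((hasDerivAt_id x).const_add c).hasDerivWithinAt hmaps)
      (by simpa using hfc)
      (by simpa using (hf2.mono_set hright).comp_add_left c)
      (by simpa using (hf'2.mono_set hright).comp_add_left c)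
    rw [intervalIntegral.integral_comp_add_left (fun x => ‖f x‖ ^ 2),
      intervalIntegral.integral_comp_add_left (fun x => ‖f' x‖ ^ 2)] at h
    simpa using h
  rw [← intervalIntegral.integral_add_adjacent_intervals (hf2.mono_set hleft)
      (hf2.mono_set hright),
    ← intervalIntegral.integral_add_adjacent_intervals (hf'2.mono_set hleft)
      (hf'2.mono_set hright), mul_add]
  have hl0 : 0 ≤ ∫ x in a..c, ‖f' x‖ ^ 2 :=
    intervalIntegral.integral_nonneg hac.le fun _ _ => by positivity
  have hr0 : 0 ≤ ∫ x in c..b, ‖f' x‖ ^ 2 :=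
    intervalIntegral.integral_nonneg hcb.le fun _ _ => by positivity
  refine add_le_add (hl.trans ?_) (hr.trans ?_)
  · gcongr
    exact le_max_right _ _
  · gcongr
    exact le_max_left _ _
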